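/- Let n be even and let τ ∈ S_n be a non-crossing pairing, i.e., every cycle of τ has length exactly 2 and #(τ) + #(τ⁻¹γ_n) = n + 1, where γ_n = (1,2,...,n). Then τ is parity alternating: for every a ∈ {1,...,n}, a and τ(a) have opposite parities. -/

import Mathlib

open Equiv MeasureTheory ProbabilityTheory Filter

noncomputable section

/-- Number of fixed points of a permutation of `Fin N`. -/
def fixCount {N : ℕ} (σ : Equiv.Perm (Fin N)) : ℕ :=
  (Finset.univ.filter fun i => σ i = i).card

/-- The set of minimal representatives of the cycles (orbits) of a permutation,
fixed points counting as cycles of length 1. -/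
def cycleReps {N : ℕ} (τ : Equiv.Perm (Fin N)) : Finset (Fin N) :=
  Finset.univ.filter fun a => ∀ k ∈ Finset.range N, a ≤ (τ ^ k) a

/-- The number of cycles of a permutation (fixed points included). -/
def cycleCount {N : ℕ} (τ : Equiv.Perm (Fin N)) : ℕ := (cycleReps τ).card

/-- Substitution of the permutations `σ 1, ..., σ s` for the generators in a word
of the free group on `s` generators. -/
def wordPerm {s N : ℕ} (σ : Fin s → Equiv.Perm (Fin N)) (w : FreeGroup (Fin s)) :
    Equiv.Perm (Fin N) := FreeGroup.lift σ w

/-- For a cycle `C = (a, τ a, τ² a, ...)` of `τ` (with representative `a`), the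
concatenated word `w_C = w_a · w_{τ a} · ... `. -/
def cycleWord {n s : ℕ} (τ : Equiv.Perm (Fin n)) (w : Fin n → FreeGroup (Fin s)) (a : Fin n) :
    FreeGroup (Fin s) :=
  ((List.range (Function.minimalPeriod τ a)).map fun i => w ((τ ^ i) a)).prod

/-- The permutation matrix of `σ`: `(i,j)` entry is `1` iff `σ j = i`. -/
def permMat (N : ℕ) (σ : Equiv.Perm (Fin N)) : Matrix (Fin N) (Fin N) ℂ :=
  Matrix.of fun i j => if σ j = i then 1 else 0

/-- The permutation `γ_{m,n} = (1,...,m)(m+1,...,m+n)`. -/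
def gammaMN (m n : ℕ) : Equiv.Perm (Fin (m + n)) :=
  (finSumFinEquiv.symm.trans ((Equiv.sumCongr (finRotate m) (finRotate n)).trans finSumFinEquiv))

instance measurableSpacePermFin {N : ℕ} : MeasurableSpace (Equiv.Perm (Fin N)) := ⊤

/-- Functions invariant under a permutation. -/
def invFun' {n : ℕ} (σ : Equiv.Perm (Fin n)) : Submodule (ZMod 2) (Fin n → ZMod 2) where
  carrier := {f | ∀ a, f (σ a) = f a}
  add_mem' := by
    intro f g hf hg a
    simp [hf a, hg a]
  zero_mem' := by intro a; rfl
  smul_mem' := by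
    intro c f hf a
    simp [hf a]

theorem reps_le_of_sameCycle {n : ℕ} (σ : Equiv.Perm (Fin n)) {a b : Fin n}
    (ha : a ∈ cycleReps σ) (h : σ.SameCycle a b) : a ≤ b := by
  by_cases hs : a ∈ σ.support
  · obtain ⟨i, hi, rfl⟩ := h.exists_pow_eq_of_mem_support hs
    have hc : (σ.cycleOf a).support.card ≤ n := by
      simpa using Finset.card_le_univ (σ.cycleOf a).support
    exact (Finset.mem_filter.mp ha).2 i (Finset.mem_range.mpr (lt_of_lt_of_le hi hc))
  · obtain ⟨i, rfl⟩ := h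
    have hfix : σ a = a := by simpa using hs
    rw [Equiv.Perm.zpow_apply_eq_self_of_apply_eq_self hfix]

theorem cycleCount_le_finrank {n : ℕ} (σ : Equiv.Perm (Fin n)) :
    cycleCount σ ≤ Module.finrank (ZMod 2) (invFun' σ) := by
  classical
  let Q := Quotient (Equiv.Perm.SameCycle.setoid σ)
  have h1 : cycleCount σ ≤ Fintype.card Q := by
    have := Fintype.card_le_of_injective
      (fun a : cycleReps σ => (Quotient.mk (Equiv.Perm.SameCycle.setoid σ) a.1 : Q)) (by
        intro a b hab
        have h : σ.SameCycle a.1 b.1 := Quotient.exact hab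
        exact Subtype.ext (le_antisymm (reps_le_of_sameCycle σ a.2 h)
          (reps_le_of_sameCycle σ b.2 h.symm)))
    simpa [cycleCount] using this
  let L : (Q → ZMod 2) →ₗ[ZMod 2] (Fin n → ZMod 2) :=
    LinearMap.funLeft (ZMod 2) (ZMod 2) (Quotient.mk (Equiv.Perm.SameCycle.setoid σ))
  have hL : Function.Injective L :=
    LinearMap.funLeft_injective_of_surjective _ _ _ Quotient.mk_surjective
  have hmem : ∀ c, L c ∈ invFun' σ := by
    intro c a
    change c _ = c _
    congr 1
    apply Quotient.sound
    change σ.SameCycle (σ a) a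
    exact Equiv.Perm.sameCycle_apply_left.mpr (Equiv.Perm.SameCycle.refl σ a)
  have h2 := LinearMap.finrank_le_finrank_of_injective (f := L.codRestrict (invFun' σ) hmem)
    (by
      intro x y hxy
      exact hL (congrArg Subtype.val hxy))
  rw [Module.finrank_fintype_fun_eq_card] at h2
  exact h1.trans h2

/-- A non-crossing pairing of `{1,...,n}` (`n` even) is parity alternating. -/
theorem stmt4 {n : ℕ} (hn : Even n) (τ : Equiv.Perm (Fin n))
    (hpair : ∀ a, τ a ≠ a ∧ τ (τ a) = a)
    (hnc : cycleCount τ + cycleCount (τ⁻¹ * finRotate n) = n + 1) :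
    ∀ a : Fin n, (a : ℕ) % 2 ≠ ((τ a : ℕ)) % 2 := by
  rcases n with _ | m
  · intro a; exact a.elim0
  have hσ : ∀ a, (τ⁻¹ * finRotate (m+1)) a = τ (a + 1) := by
    intro a
    rw [Equiv.Perm.mul_apply, finRotate_apply, Equiv.Perm.inv_eq_iff_eq, (hpair _).2]
  set σ := τ⁻¹ * finRotate (m+1) with hσdef
  have hstep : ∀ (c : ZMod 2) (g : Fin (m+1) → ZMod 2), (∀ a, g (a + 1) = g a + c) →
      ∀ a : Fin (m+1), g a = g 0 + (a : ℕ) * c := by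
    intro c g hg a
    induction a using Fin.induction with
    | zero => simp
    | succ i ih =>
      rw [← Fin.coeSucc_eq_succ, hg, ih, Fin.coeSucc_eq_succ]
      simp
      ring
  have hinf : invFun' τ ⊓ invFun' σ ≤ Submodule.span (ZMod 2) {fun _ => 1} := by
    rintro f ⟨h1, h2⟩
    rw [Submodule.mem_span_singleton]
    refine ⟨f 0, ?_⟩
    have := hstep 0 f (fun a => by
      have h3 := h2 a
      rw [hσ, h1] at h3
      simpa using h3)
    funext a
    rw [this a]
    simp
  have hinf1 : Module.finrank (ZMod 2) ↥(invFun' τ ⊓ invFun' σ) ≤ 1 :=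
    (Submodule.finrank_mono hinf).trans (by
      simpa using finrank_span_le_card (R := ZMod 2) ({fun _ => 1} : Set (Fin (m+1) → ZMod 2)))
  have hsum := Submodule.finrank_sup_add_finrank_inf_eq (invFun' τ) (invFun' σ)
  have hτ1 := cycleCount_le_finrank τ
  have hσ1 := cycleCount_le_finrank σ
  have htop : invFun' τ ⊔ invFun' σ = ⊤ := by
    apply Submodule.eq_top_of_finrank_eq
    have hle := Submodule.finrank_le (invFun' τ ⊔ invFun' σ)
    rw [Module.finrank_fintype_fun_eq_card, Fintype.card_fin] at hle ⊢
    omega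
  let f : Fin (m+1) → ZMod 2 := fun a => if a < τ a then 1 else 0
  have hf : ∀ a, f (τ a) = f a + 1 := by
    intro a
    simp only [f, (hpair a).2]
    rcases lt_or_gt_of_ne (hpair a).1 with h | h
    · simp [h, h.not_gt]
    · simp [h, h.not_gt]
      decide
  have hfm : f ∈ invFun' τ ⊔ invFun' σ := htop ▸ Submodule.mem_top
  obtain ⟨h, hh, g, hg, hfg⟩ := Submodule.mem_sup.mp hfm
  have hgτ : ∀ a, g (τ a) = g a + 1 := by
    intro a
    have e1 := congrFun hfg a
    have e2 := congrFun hfg (τ a)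
    have e3 := hf a
    rw [← e1, ← e2] at e3
    simp only [Pi.add_apply] at e3
    rw [hh a, add_assoc] at e3
    exact add_left_cancel e3
  have hgγ : ∀ a, g (a + 1) = g a + 1 := by
    intro a
    have e := hg a
    rw [hσ, hgτ] at e
    rw [← e, add_assoc, show (1 + 1 : ZMod 2) = 0 from by decide, add_zero]
  have hpar := hstep 1 g hgγ
  intro a hcon
  have e := hgτ a
  rw [hpar a, hpar (τ a), (ZMod.natCast_eq_natCast_iff' _ _ 2).mpr hcon] at e
  simp at e
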